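/- For indices k < j in {1,…,n}, let P_{ε_i,x_j}(¬x_k) denote the set of paths from ε_i to x_j that do NOT pass through x_k. Then Q_ξ(P_{ε_i,x_j}(¬x_k)) = Q_ξ(P_{ε_i,x_j}) − Q_ξ(P_{ε_i,x_j}(x_k)), and in closed form Q_ξ(P_{ε_i,x_j}(¬x_k)) = ξ·( Φ_{j,i} − Φ_{k,i}·((I−B)^{-1})_{j,k} ), where P_{ε_i,x_j}(x_k) is the set of paths from ε_i to x_j passing through x_k. -/

import Mathlib

open Matrix Finset

namespace TCA

variable {n m : ℕ}

/-- Weight of the tail of a path after a given previous index: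
for `prev` and `[k₁, …, k_t]` this is `B k₁ prev * B k₂ k₁ * ⋯ * B k_t k_{t-1}`. -/
def tailWeight (B : Matrix (Fin n) (Fin n) ℝ) : Fin n → List (Fin n) → ℝ
  | _, [] => 1
  | prev, k :: rest => B k prev * tailWeight B k rest

/-- Weight of a shock-to-variable path `[k₀, …, k_t]` for shock `i`:
`Ω k₀ i * B k₁ k₀ * ⋯ * B k_t k_{t−1}`. -/
def shockListWeight (B : Matrix (Fin n) (Fin n) ℝ) (Ω : Matrix (Fin n) (Fin m) ℝ)
    (i : Fin m) : List (Fin n) → ℝ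
  | [] => 0
  | k :: rest => Ω k i * tailWeight B k rest

/-- Weight of a variable-to-variable path `[k₀, …, k_t]`:
`B k₁ k₀ * ⋯ * B k_t k_{t−1}` (equal to `1` for a single-element path). -/
def varListWeight (B : Matrix (Fin n) (Fin n) ℝ) : List (Fin n) → ℝ
  | [] => 0
  | k :: rest => tailWeight B k rest

/-- A path from the shock to `x_j`, identified with its (nonempty) set of indices:
a strictly increasing sequence ending at `j` is exactly a finite set containing `j`
with all elements `≤ j`. -/
def PathTo (j : Fin n) (S : Finset (Fin n)) : Prop := j ∈ S ∧ ∀ k ∈ S, k ≤ j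

/-- A path from `x_r` to `x_s`, identified with its set of indices: a strictly
increasing sequence starting at `r` and ending at `s`. -/
def PathBetween (r s : Fin n) (S : Finset (Fin n)) : Prop :=
  r ∈ S ∧ s ∈ S ∧ ∀ k ∈ S, r ≤ k ∧ k ≤ s

instance (j : Fin n) : DecidablePred (PathTo j) := fun _ => by
  unfold PathTo; infer_instance

instance (r s : Fin n) : DecidablePred (PathBetween r s) := fun _ => by
  unfold PathBetween; infer_instance

/-- The set `P_{ε_i, x_j}` of all paths from the shock to `x_j`. -/
def allPathsTo (j : Fin n) : Finset (Finset (Fin n)) :=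
  Finset.univ.filter (PathTo j)

/-- The set `P_{x_r, x_s}` of all paths from `x_r` to `x_s`. -/
def allPathsBetween (r s : Fin n) : Finset (Finset (Fin n)) :=
  Finset.univ.filter (PathBetween r s)

/-- Weight of a shock-to-variable path given as a set of indices (the weight of its
strictly increasing enumeration). -/
def wShock (B : Matrix (Fin n) (Fin n) ℝ) (Ω : Matrix (Fin n) (Fin m) ℝ)
    (i : Fin m) (S : Finset (Fin n)) : ℝ :=
  shockListWeight B Ω i (S.sort (· ≤ ·))

/-- Weight of a variable-to-variable path given as a set of indices. -/
def wVar (B : Matrix (Fin n) (Fin n) ℝ) (S : Finset (Fin n)) : ℝ :=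
  varListWeight B (S.sort (· ≤ ·))

/-- Total path-specific effect `Q_ξ(P) = ξ · Σ_{p ∈ P} weight(p)`. -/
def Q (ξ : ℝ) (w : Finset (Fin n) → ℝ) (P : Finset (Finset (Fin n))) : ℝ :=
  ξ * ∑ p ∈ P, w p


/-- Extending a list of indices whose last entry is `l` by one further index `j`. -/
theorem tailWeight_append_singleton (B : Matrix (Fin n) (Fin n) ℝ) (j : Fin n)
    (L : List (Fin n)) (a : Fin n) :
    tailWeight B a (L ++ [j])
      = tailWeight B a L * B j ((a :: L).getLast (List.cons_ne_nil a L)) := by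
  induction L generalizing a with
  | nil => simp [tailWeight]
  | cons b L ih =>
    rw [List.cons_append, tailWeight, ih b, tailWeight, List.getLast_cons_cons, mul_assoc]

theorem shockListWeight_append_singleton (B : Matrix (Fin n) (Fin n) ℝ)
    (Ω : Matrix (Fin n) (Fin m) ℝ) (i : Fin m) (j : Fin n) (L : List (Fin n)) (hL : L ≠ []) :
    shockListWeight B Ω i (L ++ [j]) = shockListWeight B Ω i L * B j (L.getLast hL) := by
  cases L with
  | nil => exact absurd rfl hL
  | cons a L =>
    rw [List.cons_append, shockListWeight, tailWeight_append_singleton, shockListWeight, mul_assoc]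

/-- Inserting a new maximum appends it to the sorted enumeration. -/
theorem sort_insert_of_forall_lt (j : Fin n) (T : Finset (Fin n)) (h : ∀ x ∈ T, x < j) :
    (insert j T).sort (· ≤ ·) = T.sort (· ≤ ·) ++ [j] := by
  have hj : j ∉ T := fun hj => lt_irrefl j (h j hj)
  refine List.Perm.eq_of_pairwise' (r := (· ≤ ·)) (Finset.pairwise_sort _ _) ?_ ?_
  · rw [List.pairwise_append]
    refine ⟨Finset.pairwise_sort _ _, List.pairwise_singleton _ _, fun a ha b hb => ?_⟩
    rw [List.mem_singleton.1 hb]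
    exact (h a ((Finset.mem_sort _).1 ha)).le
  · rw [List.perm_ext_iff_of_nodup (Finset.sort_nodup _ _)]
    · intro a
      simp [or_comm]
    · rw [List.nodup_append]
      refine ⟨Finset.sort_nodup _ _, List.nodup_singleton _, fun a ha b hb => ?_⟩
      rw [List.mem_singleton.1 hb]
      exact (h a ((Finset.mem_sort _).1 ha)).ne

theorem wShock_singleton (B : Matrix (Fin n) (Fin n) ℝ) (Ω : Matrix (Fin n) (Fin m) ℝ)
    (i : Fin m) (j : Fin n) : wShock B Ω i {j} = Ω j i := by
  simp [wShock, shockListWeight, tailWeight]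

theorem wShock_insert (B : Matrix (Fin n) (Fin n) ℝ) (Ω : Matrix (Fin n) (Fin m) ℝ)
    (i : Fin m) {l j : Fin n} (hlj : l < j) {T : Finset (Fin n)} (hT : PathTo l T) :
    wShock B Ω i (insert j T) = B j l * wShock B Ω i T := by
  have hlt : ∀ x ∈ T, x < j := fun x hx => (hT.2 x hx).trans_lt hlj
  have hT' : T = insert l (T.erase l) := (Finset.insert_erase hT.1).symm
  have hsort : T.sort (· ≤ ·) = (T.erase l).sort (· ≤ ·) ++ [l] := by
    conv_lhs => rw [hT']
    refine sort_insert_of_forall_lt l _ fun x hx => ?_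
    exact lt_of_le_of_ne (hT.2 x (Finset.mem_of_mem_erase hx)) (Finset.ne_of_mem_erase hx)
  rw [wShock, wShock, sort_insert_of_forall_lt j T hlt, hsort,
    shockListWeight_append_singleton _ _ _ _ _ (by simp), List.getLast_append_singleton, mul_comm]

theorem mem_allPathsTo {j : Fin n} {S : Finset (Fin n)} : S ∈ allPathsTo j ↔ PathTo j S := by
  simp [allPathsTo]

theorem PathTo.unique {l l' : Fin n} {T : Finset (Fin n)} (h : PathTo l T) (h' : PathTo l' T) :
    l = l' :=
  le_antisymm (h'.2 l h.1) (h.2 l' h'.1)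

/-- Splitting off the last edge of the paths to `x_j` that avoid `x_k`. -/
theorem sum_wShock_not_through (B : Matrix (Fin n) (Fin n) ℝ) (Ω : Matrix (Fin n) (Fin m) ℝ)
    (i : Fin m) {k j : Fin n} (hkj : k ≠ j) :
    ∑ S ∈ (allPathsTo j).filter (fun S => k ∉ S), wShock B Ω i S
      = Ω j i + ∑ l ∈ Finset.Iio j,
          B j l * ∑ S ∈ (allPathsTo l).filter (fun S => k ∉ S), wShock B Ω i S := by
  have hmem : {j} ∈ (allPathsTo j).filter (fun S => k ∉ S) := by
    simp [mem_allPathsTo, PathTo, hkj]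
  rw [← Finset.add_sum_erase _ _ hmem, wShock_singleton]
  simp_rw [Finset.mul_sum]
  rw [Finset.sum_sigma']
  congr 1
  symm
  refine Finset.sum_bij (fun p _ => insert j p.2) ?_ ?_ ?_ ?_
  · rintro ⟨l, T⟩ hp
    simp only [Finset.mem_sigma, Finset.mem_Iio, Finset.mem_filter, mem_allPathsTo] at hp
    obtain ⟨hlj, hT, hk⟩ := hp
    simp only [Finset.mem_erase, Finset.mem_filter, mem_allPathsTo]
    refine ⟨fun h => ?_, ⟨Finset.mem_insert_self _ _, fun x hx => ?_⟩, ?_⟩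
    · have hl : l ∈ insert j T := Finset.mem_insert_of_mem hT.1
      rw [h, Finset.mem_singleton] at hl
      exact hlj.ne hl
    · rcases Finset.mem_insert.1 hx with rfl | hx
      · exact le_rfl
      · exact (hT.2 x hx).trans hlj.le
    · simp [hkj, hk]
  · rintro ⟨l, T⟩ hp ⟨l', T'⟩ hp' heq
    simp only [Finset.mem_sigma, Finset.mem_Iio, Finset.mem_filter, mem_allPathsTo] at hp hp'
    obtain ⟨hlj, hT, -⟩ := hp
    obtain ⟨hlj', hT', -⟩ := hp'
    have hj : j ∉ T := fun h => (hT.2 j h).not_gt hlj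
    have hj' : j ∉ T' := fun h => (hT'.2 j h).not_gt hlj'
    have hTT : T = T' := by
      rw [← Finset.erase_insert hj, ← Finset.erase_insert hj']
      exact congrArg (fun S => Finset.erase S j) heq
    subst hTT
    obtain rfl := hT.unique hT'
    rfl
  · intro S hS
    simp only [Finset.mem_erase, Finset.mem_filter, mem_allPathsTo] at hS
    obtain ⟨hne, hS, hk⟩ := hS
    have hnonempty : (S.erase j).Nonempty := by
      rw [Finset.nonempty_iff_ne_empty]
      intro h
      rcases (Finset.erase_eq_empty_iff S j).1 h with h | h
      · simp [h] at hS
        exact absurd hS.1 (Finset.notMem_empty j)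
      · exact hne h
    have hmax := Finset.max'_mem _ hnonempty
    refine ⟨⟨(S.erase j).max' hnonempty, S.erase j⟩, ?_, Finset.insert_erase hS.1⟩
    simp only [Finset.mem_sigma, Finset.mem_Iio, Finset.mem_filter, mem_allPathsTo]
    refine ⟨?_, ⟨hmax, fun x hx => Finset.le_max' _ x hx⟩, fun h => hk (Finset.mem_of_mem_erase h)⟩
    exact lt_of_le_of_ne (hS.2 _ (Finset.mem_of_mem_erase hmax)) (Finset.ne_of_mem_erase hmax)
  · rintro ⟨l, T⟩ hp
    simp only [Finset.mem_sigma, Finset.mem_Iio, Finset.mem_filter, mem_allPathsTo] at hp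
    exact (wShock_insert B Ω i hp.1 hp.2.1).symm

theorem isUnit_det_one_sub (B : Matrix (Fin n) (Fin n) ℝ)
    (hB : ∀ j k : Fin n, j ≤ k → B j k = 0) : IsUnit (1 - B).det := by
  have h : (1 - B).BlockTriangular OrderDual.toDual := fun a b hab => by
    have hab' : a < b := hab
    simp [Matrix.one_apply_ne hab'.ne, hB a b hab'.le]
  rw [Matrix.det_of_isLowerTriangular _ h]
  simp [hB _ _ le_rfl]

/-- The resolvent of a strictly lower triangular matrix solves the forward recursion. -/
theorem inv_one_sub_mul_apply {ι : Type*} (B : Matrix (Fin n) (Fin n) ℝ)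
    (hB : ∀ j k : Fin n, j ≤ k → B j k = 0) (M : Matrix (Fin n) ι ℝ) (j : Fin n) (i : ι) :
    ((1 - B)⁻¹ * M) j i = M j i + ∑ l ∈ Finset.Iio j, B j l * ((1 - B)⁻¹ * M) l i := by
  have h : (1 - B) * ((1 - B)⁻¹ * M) = M :=
    Matrix.mul_nonsing_inv_cancel_left _ _ (isUnit_det_one_sub B hB)
  have hji := congrFun (congrFun h j) i
  rw [Matrix.sub_mul, Matrix.one_mul, Matrix.sub_apply, Matrix.mul_apply (M := B)] at hji
  have hsum : ∑ l ∈ Finset.Iio j, B j l * ((1 - B)⁻¹ * M) l i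
      = ∑ l, B j l * ((1 - B)⁻¹ * M) l i := by
    refine Finset.sum_subset (Finset.subset_univ _) fun l _ hl => ?_
    rw [hB j l (not_lt.1 fun h => hl (Finset.mem_Iio.2 h)), zero_mul]
  rw [hsum]
  linarith

theorem inv_one_sub_apply (B : Matrix (Fin n) (Fin n) ℝ)
    (hB : ∀ j k : Fin n, j ≤ k → B j k = 0) (j k : Fin n) :
    (1 - B)⁻¹ j k
      = (1 : Matrix (Fin n) (Fin n) ℝ) j k + ∑ l ∈ Finset.Iio j, B j l * (1 - B)⁻¹ l k := by
  simpa only [Matrix.mul_one] using inv_one_sub_mul_apply B hB 1 j k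

theorem inv_one_sub_apply_of_lt (B : Matrix (Fin n) (Fin n) ℝ)
    (hB : ∀ j k : Fin n, j ≤ k → B j k = 0) (k j : Fin n) (hjk : j < k) :
    (1 - B)⁻¹ j k = 0 := by
  induction j using WellFoundedLT.induction with
  | ind j ih =>
    rw [inv_one_sub_apply B hB, Matrix.one_apply_ne hjk.ne, zero_add]
    refine Finset.sum_eq_zero fun l hl => ?_
    have hlj := Finset.mem_Iio.1 hl
    rw [ih l hlj (hlj.trans hjk), mul_zero]

theorem inv_one_sub_apply_self (B : Matrix (Fin n) (Fin n) ℝ)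
    (hB : ∀ j k : Fin n, j ≤ k → B j k = 0) (k : Fin n) : (1 - B)⁻¹ k k = 1 := by
  rw [inv_one_sub_apply B hB, Matrix.one_apply_eq, Finset.sum_eq_zero, add_zero]
  intro l hl
  rw [inv_one_sub_apply_of_lt B hB k l (Finset.mem_Iio.1 hl), mul_zero]

/-- Closed form for the total weight of the paths to `x_j` that avoid `x_k`. -/
theorem sum_wShock_not_through_eq (B : Matrix (Fin n) (Fin n) ℝ) (Ω : Matrix (Fin n) (Fin m) ℝ)
    (hB : ∀ j k : Fin n, j ≤ k → B j k = 0) (i : Fin m) (k j : Fin n) :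
    ∑ S ∈ (allPathsTo j).filter (fun S => k ∉ S), wShock B Ω i S
      = ((1 - B)⁻¹ * Ω) j i - ((1 - B)⁻¹ * Ω) k i * (1 - B)⁻¹ j k := by
  induction j using WellFoundedLT.induction with
  | ind j ih =>
    rcases eq_or_ne k j with rfl | hkj
    · rw [inv_one_sub_apply_self B hB, mul_one, sub_self]
      refine Finset.sum_eq_zero fun S hS => ?_
      rw [Finset.mem_filter, mem_allPathsTo] at hS
      exact absurd hS.1.1 hS.2
    · rw [sum_wShock_not_through B Ω i hkj, inv_one_sub_mul_apply B hB Ω j i,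
        inv_one_sub_apply B hB j k, Matrix.one_apply_ne hkj.symm, zero_add, Finset.mul_sum,
        add_sub_assoc, ← Finset.sum_sub_distrib]
      congr 1
      refine Finset.sum_congr rfl fun l hl => ?_
      rw [ih l (Finset.mem_Iio.1 hl)]
      ring

/-- for `k < j`, the effect of the paths from `ε_i` to `x_j` NOT
going through `x_k` is the total effect minus the effect through `x_k`, and in
closed form `ξ·(Φ_{j,i} − Φ_{k,i}·((I−B)⁻¹)_{j,k})`. -/
theorem not_through_effect (n m : ℕ) (hn : 0 < n) (hm : 0 < m)
    (B : Matrix (Fin n) (Fin n) ℝ) (Ω : Matrix (Fin n) (Fin m) ℝ)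
    (hB : ∀ j k : Fin n, j ≤ k → B j k = 0)
    (i : Fin m) (k j : Fin n) (hkj : k < j) (ξ : ℝ) :
    Q ξ (wShock B Ω i) ((allPathsTo j).filter (fun S => k ∉ S))
      = Q ξ (wShock B Ω i) (allPathsTo j)
        - Q ξ (wShock B Ω i) ((allPathsTo j).filter (fun S => k ∈ S)) ∧
    Q ξ (wShock B Ω i) ((allPathsTo j).filter (fun S => k ∉ S))
      = ξ * (((1 - B)⁻¹ * Ω) j i - ((1 - B)⁻¹ * Ω) k i * (1 - B)⁻¹ j k) := by
  refine ⟨?_, by rw [Q, sum_wShock_not_through_eq B Ω hB]⟩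
  rw [Q, Q, Q, ← Finset.sum_filter_add_sum_filter_not (allPathsTo j) (fun S => k ∈ S)]
  ring

end TCA
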